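/- Let (ξ, ρ) be a shuffle morphism from (n̄, m̄, r̄, s̄) to (n, m, r, s) and let (ξ', ρ') be a shuffle morphism from (n, m, r, s) to (ñ, m̃, r̃, s̃), where the shuffle morphism condition for (ξ, ρ) reads: L r̃' ... explicitly, ξ : Fin (n̄+1) → Fin (n+1) and ρ : Fin (m̄+1) → Fin (m+1) are interval maps with L r (ξ (r̄ i)) ≤ R s (ρ (s̄ i)) for all i : Fin (n̄+m̄+1), and ξ' : Fin (n+1) → Fin (ñ+1), ρ' : Fin (m+1) → Fin (m̃+1) are interval maps with L r̃ (ξ' (r i)) ≤ R s̃ (ρ' (s i)) for all i : Fin (n+m+1). Then the componentwise composite (ξ' ∘ ξ, ρ' ∘ ρ) is a shuffle morphism from (n̄, m̄, r̄, s̄) to (ñ, m̃, r̃, s̃): L r̃ (ξ' (ξ (r̄ i))) ≤ R s̃ (ρ' (ρ (s̄ i))) for all i : Fin (n̄+m̄+1). -/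

import Mathlib

/-- For a monotone map `ξ : Fin (n+1) → Fin (m+1)` with `ξ (Fin.last n) = Fin.last m`,
`Lmap ξ hξ i` is the least `j` with `i ≤ ξ j`. -/
def Lmap {n m : ℕ} (ξ : Fin (n+1) → Fin (m+1)) (hξ : ξ (Fin.last n) = Fin.last m)
    (i : Fin (m+1)) : Fin (n+1) :=
  Finset.min' (Finset.univ.filter fun j => i ≤ ξ j)
    ⟨Fin.last n, Finset.mem_filter.mpr ⟨Finset.mem_univ _, by rw [hξ]; exact Fin.le_last i⟩⟩

/-- For a monotone map `ξ : Fin (n+1) → Fin (m+1)` with `ξ 0 = 0`,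
`Rmap ξ hξ i` is the greatest `j` with `ξ j ≤ i`. -/
def Rmap {n m : ℕ} (ξ : Fin (n+1) → Fin (m+1)) (hξ : ξ 0 = 0)
    (i : Fin (m+1)) : Fin (n+1) :=
  Finset.max' (Finset.univ.filter fun j => ξ j ≤ i)
    ⟨0, Finset.mem_filter.mpr ⟨Finset.mem_univ _, by rw [hξ]; exact Fin.zero_le i⟩⟩

/-- The first leg of a shuffle automatically preserves the top element. -/
lemma shuffle_r_last {n m : ℕ}
    (r : Fin (n+m+1) → Fin (n+1)) (s : Fin (n+m+1) → Fin (m+1))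
    (hsum : ∀ i : Fin (n+m+1), (r i : ℕ) + (s i : ℕ) = (i : ℕ)) :
    r (Fin.last (n+m)) = Fin.last n := by
  have h := hsum (Fin.last (n+m))
  have h1 : (r (Fin.last (n+m)) : ℕ) ≤ n := Fin.is_le _
  have h2 : (s (Fin.last (n+m)) : ℕ) ≤ m := Fin.is_le _
  apply Fin.ext
  simp only [Fin.val_last] at h ⊢
  omega

/-- The second leg of a shuffle automatically preserves the bottom element. -/
lemma shuffle_s_zero {n m : ℕ}
    (r : Fin (n+m+1) → Fin (n+1)) (s : Fin (n+m+1) → Fin (m+1))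
    (hsum : ∀ i : Fin (n+m+1), (r i : ℕ) + (s i : ℕ) = (i : ℕ)) :
    s 0 = 0 := by
  have h := hsum 0
  apply Fin.ext
  simp only [Fin.val_zero] at h ⊢
  omega

lemma le_apply_Lmap {n m : ℕ} (ξ : Fin (n+1) → Fin (m+1)) (hξ : ξ (Fin.last n) = Fin.last m)
    (i : Fin (m+1)) : i ≤ ξ (Lmap ξ hξ i) :=
  (Finset.mem_filter.mp (Finset.min'_mem (Finset.univ.filter fun j => i ≤ ξ j) _)).2

lemma apply_Rmap_le {n m : ℕ} (ξ : Fin (n+1) → Fin (m+1)) (hξ : ξ 0 = 0)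
    (i : Fin (m+1)) : ξ (Rmap ξ hξ i) ≤ i :=
  (Finset.mem_filter.mp (Finset.max'_mem (Finset.univ.filter fun j => ξ j ≤ i) _)).2

lemma Lmap_mono {n m : ℕ} (ξ : Fin (n+1) → Fin (m+1)) (hξ : ξ (Fin.last n) = Fin.last m) :
    Monotone (Lmap ξ hξ) := fun a b hab =>
  Finset.min'_le (Finset.univ.filter fun j => a ≤ ξ j) _ (Finset.mem_filter.mpr
    ⟨Finset.mem_univ _, hab.trans (le_apply_Lmap ξ hξ b)⟩)

lemma Rmap_mono {n m : ℕ} (ξ : Fin (n+1) → Fin (m+1)) (hξ : ξ 0 = 0) :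
    Monotone (Rmap ξ hξ) := fun a b hab =>
  Finset.le_max' (Finset.univ.filter fun j => ξ j ≤ b) _ (Finset.mem_filter.mpr
    ⟨Finset.mem_univ _, (apply_Rmap_le ξ hξ a).trans hab⟩)

theorem shuffle_morphism_comp
    {n₁ m₁ n₂ m₂ n₃ m₃ : ℕ}
    (r₁ : Fin (n₁+m₁+1) → Fin (n₁+1)) (s₁ : Fin (n₁+m₁+1) → Fin (m₁+1))
    (r₂ : Fin (n₂+m₂+1) → Fin (n₂+1)) (s₂ : Fin (n₂+m₂+1) → Fin (m₂+1))
    (r₃ : Fin (n₃+m₃+1) → Fin (n₃+1)) (s₃ : Fin (n₃+m₃+1) → Fin (m₃+1))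
    (hr₁ : Monotone r₁) (hs₁ : Monotone s₁)
    (hr₂ : Monotone r₂) (hs₂ : Monotone s₂)
    (hr₃ : Monotone r₃) (hs₃ : Monotone s₃)
    (hsum₁ : ∀ i : Fin (n₁+m₁+1), (r₁ i : ℕ) + (s₁ i : ℕ) = (i : ℕ))
    (hsum₂ : ∀ i : Fin (n₂+m₂+1), (r₂ i : ℕ) + (s₂ i : ℕ) = (i : ℕ))
    (hsum₃ : ∀ i : Fin (n₃+m₃+1), (r₃ i : ℕ) + (s₃ i : ℕ) = (i : ℕ))
    (ξ : Fin (n₁+1) → Fin (n₂+1)) (ρ : Fin (m₁+1) → Fin (m₂+1))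
    (ξ' : Fin (n₂+1) → Fin (n₃+1)) (ρ' : Fin (m₂+1) → Fin (m₃+1))
    (hξ : Monotone ξ) (hξ0 : ξ 0 = 0) (hξl : ξ (Fin.last n₁) = Fin.last n₂)
    (hρ : Monotone ρ) (hρ0 : ρ 0 = 0) (hρl : ρ (Fin.last m₁) = Fin.last m₂)
    (hξ' : Monotone ξ') (hξ'0 : ξ' 0 = 0) (hξ'l : ξ' (Fin.last n₂) = Fin.last n₃)
    (hρ' : Monotone ρ') (hρ'0 : ρ' 0 = 0) (hρ'l : ρ' (Fin.last m₂) = Fin.last m₃)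
    (hmor : ∀ i : Fin (n₁+m₁+1),
      Lmap r₂ (shuffle_r_last r₂ s₂ hsum₂) (ξ (r₁ i)) ≤
        Rmap s₂ (shuffle_s_zero r₂ s₂ hsum₂) (ρ (s₁ i)))
    (hmor' : ∀ i : Fin (n₂+m₂+1),
      Lmap r₃ (shuffle_r_last r₃ s₃ hsum₃) (ξ' (r₂ i)) ≤
        Rmap s₃ (shuffle_s_zero r₃ s₃ hsum₃) (ρ' (s₂ i))) :
    ∀ i : Fin (n₁+m₁+1),
      Lmap r₃ (shuffle_r_last r₃ s₃ hsum₃) (ξ' (ξ (r₁ i))) ≤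
        Rmap s₃ (shuffle_s_zero r₃ s₃ hsum₃) (ρ' (ρ (s₁ i))) := by
  intro i
  set k := Lmap r₂ (shuffle_r_last r₂ s₂ hsum₂) (ξ (r₁ i))
  have hrk : ξ (r₁ i) ≤ r₂ k := le_apply_Lmap _ _ _
  have hsk : s₂ k ≤ ρ (s₁ i) := (hs₂ (hmor i)).trans (apply_Rmap_le _ _ _)
  exact (Lmap_mono _ _ (hξ' hrk)).trans ((hmor' k).trans (Rmap_mono _ _ (hρ' hsk)))
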